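/- Let μ > 0 and let f ∈ C([0,1]) be such that f_μ = f/ln_μ is twice continuously differentiable on (0,1). Then |𝓛ₙᴷ(f, x) − f(x)| = o(n^{−1}) as n → +∞ for every 0 < x < 1 (i.e., n(𝓛ₙᴷ(f,x) − f(x)) → 0 pointwise on (0,1)) if and only if f satisfies the differential equation (1+μ − x(1+2μ) − x²) f_μ'(x) + (1+μ)(x − x²) f_μ''(x) = 0 for every x ∈ (0,1). -/

import Mathlib

open MeasureTheory Filter Set

/-- The logarithmic weight `ln_μ(x) = ln(1+μ+x)`. -/
noncomputable def lnMu (μ x : ℝ) : ℝ := Real.log (1 + μ + x)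

/-- The function `a_{n+1}(x)` from the paper. -/
noncomputable def aFun (μ : ℝ) (n : ℕ) (x : ℝ) : ℝ :=
  Real.log (1 + x / (((n : ℝ) + 1) * (1 + μ))) /
    Real.log (1 + 1 / (((n : ℝ) + 1) * (1 + μ)))

/-- Bernstein basis polynomial `p_{n,k}(x) = C(n,k) x^k (1-x)^{n-k}`. -/
noncomputable def bern (n k : ℕ) (x : ℝ) : ℝ :=
  (n.choose k : ℝ) * x ^ k * (1 - x) ^ (n - k)

/-- The Kantorovich logarithmic operator `𝓛ₙᴷ(f,x)`. -/
noncomputable def LK (μ : ℝ) (n : ℕ) (f : ℝ → ℝ) (x : ℝ) : ℝ :=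
  lnMu μ x * ∑ k ∈ Finset.range (n + 1),
    bern n k (aFun μ n x) * ((n : ℝ) + 1) *
      ∫ t in ((k : ℝ) / ((n : ℝ) + 1))..(((k : ℝ) + 1) / ((n : ℝ) + 1)), f t / lnMu μ t

/-- `γ_n := max_{x ∈ [0,1]} |a_{n+1}(x) - x|`. -/
noncomputable def gammaN (μ : ℝ) (n : ℕ) : ℝ :=
  ⨆ x : Set.Icc (0 : ℝ) 1, |aFun μ n (x : ℝ) - (x : ℝ)|

/-- Unweighted L^p norm `(∫₀¹ |f|^p)^(1/p)` on [0,1]. -/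
noncomputable def normP (p : ℝ) (f : ℝ → ℝ) : ℝ :=
  (∫ x in (0:ℝ)..1, |f x| ^ p) ^ (1 / p)

/-- Weighted L^p norm `(∫₀¹ |f/ln_μ|^p)^(1/p)` on [0,1]. -/
noncomputable def normPMu (μ p : ℝ) (f : ℝ → ℝ) : ℝ :=
  (∫ x in (0:ℝ)..1, |f x / lnMu μ x| ^ p) ^ (1 / p)


noncomputable def bE (n : ℕ) (a : ℝ) (F : ℝ → ℝ) : ℝ :=
  ∑ k ∈ Finset.range (n + 1), bern n k a * F k

lemma bE_succ (n : ℕ) (a : ℝ) (F : ℝ → ℝ) :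
    bE (n + 1) a F = bE n a (fun y => (1 - a) * F y + a * F (y + 1)) := by
  have h0 : bern (n + 1) 0 a = (1 - a) * bern n 0 a := by
    simp [bern, pow_succ]; ring
  have hs : ∀ k ∈ Finset.range (n + 1),
      bern (n + 1) (k + 1) a = a * bern n k a + (1 - a) * bern n (k + 1) a := by
    intro k hk
    have hk' : k ≤ n := by simpa [Nat.lt_succ_iff] using hk
    rcases hk'.lt_or_eq with h | h
    · obtain ⟨d, rfl⟩ := Nat.exists_eq_add_of_lt h
      have e1 : k + d + 1 + 1 - (k + 1) = d + 1 := by omega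
      have e2 : k + d + 1 - k = d + 1 := by omega
      have e3 : k + d + 1 - (k + 1) = d := by omega
      simp only [bern, e1, e2, e3, Nat.choose_succ_succ (k + d + 1) k]
      push_cast; ring
    · subst h
      simp [bern, pow_succ]; ring
  have hz : bern n (n + 1) a = 0 := by simp [bern]
  have key : ∑ k ∈ Finset.range (n + 1), bern n (k + 1) a * F ((k + 1 : ℕ) : ℝ) + bern n 0 a * F ((0 : ℕ) : ℝ)
      = ∑ k ∈ Finset.range (n + 1), bern n k a * F k := by
    rw [← Finset.sum_range_succ' (fun k => bern n k a * F (k : ℝ)), Finset.sum_range_succ, hz]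
    simp
  unfold bE
  rw [Finset.sum_range_succ', h0, Finset.sum_congr rfl (fun k hk => by rw [hs k hk])]
  have e : ∑ k ∈ Finset.range (n + 1), bern n k a * ((1 - a) * F k + a * F ((k : ℝ) + 1))
      = (1 - a) * ∑ k ∈ Finset.range (n + 1), bern n k a * F k
        + a * ∑ k ∈ Finset.range (n + 1), bern n k a * F ((k : ℝ) + 1) := by
    rw [Finset.mul_sum, Finset.mul_sum, ← Finset.sum_add_distrib]
    exact Finset.sum_congr rfl (fun k _ => by ring)
  rw [e, ← key, mul_add, Finset.mul_sum, Finset.mul_sum]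
  have e2 : ∑ k ∈ Finset.range (n + 1), (a * bern n k a + (1 - a) * bern n (k + 1) a) * F ((k + 1 : ℕ) : ℝ)
     = ∑ k ∈ Finset.range (n + 1), (1 - a) * (bern n (k + 1) a * F ((k + 1 : ℕ) : ℝ))
       + ∑ k ∈ Finset.range (n + 1), a * (bern n k a * F ((k : ℝ) + 1)) := by
    rw [← Finset.sum_add_distrib]
    exact Finset.sum_congr rfl (fun k _ => by push_cast; ring)
  rw [e2]; ring

lemma bE_add (n : ℕ) (a : ℝ) (F G : ℝ → ℝ) :
    bE n a (fun y => F y + G y) = bE n a F + bE n a G := by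
  simp [bE, mul_add, Finset.sum_add_distrib]

lemma bE_mul (n : ℕ) (a c : ℝ) (F : ℝ → ℝ) :
    bE n a (fun y => c * F y) = c * bE n a F := by
  simp only [bE, Finset.mul_sum]
  exact Finset.sum_congr rfl (fun k _ => by ring)

lemma bE_poly (n : ℕ) (a s c0 c1 c2 c3 c4 : ℝ) :
    bE n a (fun y => c0 * 1 + c1 * (y - s) + c2 * (y - s) ^ 2 + c3 * (y - s) ^ 3 + c4 * (y - s) ^ 4)
    = c0 * bE n a (fun _ => 1) + c1 * bE n a (fun y => y - s) + c2 * bE n a (fun y => (y - s) ^ 2)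
      + c3 * bE n a (fun y => (y - s) ^ 3) + c4 * bE n a (fun y => (y - s) ^ 4) := by
  rw [bE_add, bE_add, bE_add, bE_add, bE_mul, bE_mul, bE_mul, bE_mul, bE_mul]

lemma bE_moments (n : ℕ) (a : ℝ) :
    bE n a (fun _ => 1) = 1 ∧ bE n a (fun y => y - n * a) = 0 ∧
    bE n a (fun y => (y - n * a) ^ 2) = n * (a * (1 - a)) ∧
    bE n a (fun y => (y - n * a) ^ 3) = n * (a * (1 - a) * (1 - 2 * a)) ∧
    bE n a (fun y => (y - n * a) ^ 4) = 3 * n * (n - 1) * (a * (1 - a)) ^ 2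
      + n * (a * (1 - a) * (1 - 3 * a + 3 * a ^ 2)) := by
  induction n with
  | zero => simp [bE, bern]
  | succ n ih =>
    obtain ⟨h0, h1, h2, h3, h4⟩ := ih
    have P := bE_poly n a (n * a)
    rw [h0, h1, h2, h3, h4] at P
    simp only [bE_succ]
    refine ⟨?_, ?_, ?_, ?_, ?_⟩
    · refine Eq.trans ?_ h0
      congr 1; ext y; ring
    · convert P 0 1 0 0 0 using 2
      · ext y; push_cast; ring
      · ring
    · convert P (a * (1 - a)) 0 1 0 0 using 2
      · ext y; push_cast; ring
      · push_cast; ring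
    · convert P (a * (1 - a) * (1 - 2 * a)) (3 * (a * (1 - a))) 0 1 0 using 2
      · ext y; push_cast; ring
      · push_cast; ring
    · refine Eq.trans (Eq.trans ?_ (P (a * (1 - a) * (1 - 3 * a + 3 * a ^ 2))
        (4 * (a * (1 - a) * (1 - 2 * a))) (6 * (a * (1 - a))) 0 1)) ?_
      · congr 1; ext y; push_cast; ring
      · push_cast; ring

lemma bern_nonneg {n k : ℕ} {a : ℝ} (h0 : 0 ≤ a) (h1 : a ≤ 1) : 0 ≤ bern n k a := by
  unfold bern
  have : 0 ≤ 1 - a := by linarith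
  positivity

/-- The Kantorovich operator at a point `a`. -/
noncomputable def kT (n : ℕ) (a : ℝ) (g : ℝ → ℝ) : ℝ :=
  ∑ k ∈ Finset.range (n + 1), bern n k a * ((n : ℝ) + 1) *
      ∫ t in ((k : ℝ) / ((n : ℝ) + 1))..(((k : ℝ) + 1) / ((n : ℝ) + 1)), g t

lemma cell_le (n k : ℕ) : (k : ℝ) / ((n : ℝ) + 1) ≤ ((k : ℝ) + 1) / ((n : ℝ) + 1) := by
  gcongr; linarith

lemma cell_sub {n k : ℕ} (hk : k ∈ Finset.range (n + 1)) :
    Icc ((k : ℝ) / ((n : ℝ) + 1)) (((k : ℝ) + 1) / ((n : ℝ) + 1)) ⊆ Icc 0 1 := by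
  apply Icc_subset_Icc
  · positivity
  · rw [div_le_one (by positivity)]
    have : k + 1 ≤ n + 1 := by simpa using hk
    exact_mod_cast this

lemma cell_int {n k : ℕ} (hk : k ∈ Finset.range (n + 1)) {g : ℝ → ℝ}
    (hg : ContinuousOn g (Icc 0 1)) :
    IntervalIntegrable g volume ((k : ℝ) / ((n : ℝ) + 1)) (((k : ℝ) + 1) / ((n : ℝ) + 1)) := by
  apply ContinuousOn.intervalIntegrable
  rw [uIcc_of_le (cell_le n k)]
  exact hg.mono (cell_sub hk)

lemma kT_add {n : ℕ} {a : ℝ} {g h : ℝ → ℝ} (hg : ContinuousOn g (Icc 0 1))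
    (hh : ContinuousOn h (Icc 0 1)) :
    kT n a (fun t => g t + h t) = kT n a g + kT n a h := by
  unfold kT
  rw [← Finset.sum_add_distrib]
  refine Finset.sum_congr rfl (fun k hk => ?_)
  rw [intervalIntegral.integral_add (cell_int hk hg) (cell_int hk hh)]; ring

lemma kT_mul {n : ℕ} {a c : ℝ} {g : ℝ → ℝ} :
    kT n a (fun t => c * g t) = c * kT n a g := by
  unfold kT
  rw [Finset.mul_sum]
  refine Finset.sum_congr rfl (fun k hk => ?_)
  rw [intervalIntegral.integral_const_mul]; ring

lemma kT_mono {n : ℕ} {a : ℝ} (h0 : 0 ≤ a) (h1 : a ≤ 1) {g h : ℝ → ℝ}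
    (hg : ContinuousOn g (Icc 0 1))
    (hh : ContinuousOn h (Icc 0 1)) (H : ∀ t ∈ Icc (0:ℝ) 1, g t ≤ h t) :
    kT n a g ≤ kT n a h := by
  unfold kT
  refine Finset.sum_le_sum (fun k hk => ?_)
  have := @bern_nonneg n k a h0 h1
  refine mul_le_mul_of_nonneg_left ?_ (by positivity)
  exact intervalIntegral.integral_mono_on (cell_le n k) (cell_int hk hg) (cell_int hk hh)
    (fun t ht => H t (cell_sub hk ht))

lemma kT_abs {n : ℕ} {a : ℝ} (h0 : 0 ≤ a) (h1 : a ≤ 1) {g h : ℝ → ℝ}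
    (hg : ContinuousOn g (Icc 0 1))
    (hh : ContinuousOn h (Icc 0 1)) (H : ∀ t ∈ Icc (0:ℝ) 1, |g t| ≤ h t) :
    |kT n a g| ≤ kT n a h := by
  rw [abs_le]
  constructor
  · have := kT_mono (n := n) h0 h1 (g := fun t => (-1) * h t) (h := g) (by fun_prop) hg
      (fun t ht => by have := (abs_le.1 (H t ht)).1; linarith)
    rw [kT_mul] at this; linarith
  · exact kT_mono h0 h1 hg hh (fun t ht => (abs_le.1 (H t ht)).2)

lemma int_pow_shift (p : ℕ) (u v x : ℝ) :
    ∫ t in u..v, (t - x) ^ p = ((v - x) ^ (p + 1) - (u - x) ^ (p + 1)) / (p + 1) := by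
  rw [intervalIntegral.integral_comp_sub_right (fun t => t ^ p), integral_pow]

lemma kT_eq_bE {n : ℕ} {a : ℝ} {g F : ℝ → ℝ}
    (H : ∀ k : ℕ, ((n : ℝ) + 1) * ∫ t in ((k : ℝ) / ((n : ℝ) + 1))..(((k : ℝ) + 1) / ((n : ℝ) + 1)), g t
      = F k) : kT n a g = bE n a F := by
  unfold kT bE
  exact Finset.sum_congr rfl (fun k hk => by rw [mul_assoc, H])

lemma kT_zero (n : ℕ) (a c : ℝ) : kT n a (fun _ => c) = c := by
  rw [kT_eq_bE (F := fun _ => c * 1), bE_mul, (bE_moments n a).1, mul_one]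
  intro k
  have : (n : ℝ) + 1 ≠ 0 := by positivity
  simp; field_simp; ring

lemma kT_one (n : ℕ) (a x : ℝ) :
    kT n a (fun t => t - x) = (n * (a - x) + 1 / 2 - x) / (n + 1) := by
  have hm : (n : ℝ) + 1 ≠ 0 := by positivity
  obtain ⟨h0, h1, h2, h3, h4⟩ := bE_moments n a
  have P := bE_poly n a (n * a) ((n * (a - x) + 1 / 2 - x) / (n + 1)) (1 / (n + 1)) 0 0 0
  rw [h0, h1, h2, h3, h4] at P
  rw [kT_eq_bE, P]
  · ring
  · intro k
    have := int_pow_shift 1 (k / ((n : ℝ) + 1)) (((k : ℝ) + 1) / ((n : ℝ) + 1)) x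
    simp only [pow_one] at this
    rw [this]; push_cast; field_simp; ring

lemma kT_two (n : ℕ) (a x : ℝ) :
    kT n a (fun t => (t - x) ^ 2) =
      (n * (a * (1 - a)) + (n * (a - x) + 1 / 2 - x) ^ 2 + 1 / 12) / (n + 1) ^ 2 := by
  have hm : (n : ℝ) + 1 ≠ 0 := by positivity
  obtain ⟨h0, h1, h2, h3, h4⟩ := bE_moments n a
  have P := bE_poly n a (n * a) (((n * (a - x) + 1 / 2 - x) ^ 2 + 1 / 12) / (n + 1) ^ 2)
    (2 * (n * (a - x) + 1 / 2 - x) / (n + 1) ^ 2) (1 / (n + 1) ^ 2) 0 0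
  rw [h0, h1, h2, h3, h4] at P
  rw [kT_eq_bE, P]
  · ring
  · intro k
    rw [int_pow_shift]; push_cast; field_simp; ring

lemma kT_four (n : ℕ) (a x b : ℝ) (hb : b = n * (a - x) + 1 / 2 - x) :
    kT n a (fun t => (t - x) ^ 4) =
      ((3 * n * (n - 1) * (a * (1 - a)) ^ 2 + n * (a * (1 - a) * (1 - 3 * a + 3 * a ^ 2)))
      + 4 * b * (n * (a * (1 - a) * (1 - 2 * a))) + 6 * b ^ 2 * (n * (a * (1 - a))) + b ^ 4
      + (n * (a * (1 - a)) + b ^ 2) / 2 + 1 / 80) / (n + 1) ^ 4 := by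
  have hm : (n : ℝ) + 1 ≠ 0 := by positivity
  obtain ⟨h0, h1, h2, h3, h4⟩ := bE_moments n a
  have P := bE_poly n a (n * a) ((b ^ 4 + b ^ 2 / 2 + 1 / 80) / (n + 1) ^ 4)
    ((4 * b ^ 3 + b) / (n + 1) ^ 4) ((6 * b ^ 2 + 1 / 2) / (n + 1) ^ 4) (4 * b / (n + 1) ^ 4)
    (1 / (n + 1) ^ 4)
  rw [h0, h1, h2, h3, h4] at P
  rw [kT_eq_bE, P]
  · ring
  · intro k
    rw [int_pow_shift, hb]; push_cast; field_simp; ring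

lemma log_quot : Tendsto (fun u : ℝ => (Real.log (1 + u) - u) / u ^ 2) (nhdsWithin 0 (Ioi 0))
    (nhds (-1 / 2)) := by
  rw [tendsto_iff_norm_sub_tendsto_zero]
  have hb : Tendsto (fun u : ℝ => |u| / (1 - |u|)) (nhdsWithin 0 (Ioi 0)) (nhds 0) := by
    have : ContinuousAt (fun u : ℝ => |u| / (1 - |u|)) 0 := by
      apply ContinuousAt.div (by fun_prop) (by fun_prop); simp
    have h2 := this.tendsto
    simp only [abs_zero, zero_div] at h2
    exact h2.mono_left nhdsWithin_le_nhds
  have h1 : ∀ᶠ u : ℝ in nhdsWithin 0 (Ioi 0), u < 1 :=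
    nhdsWithin_le_nhds (Iio_mem_nhds one_pos)
  refine tendsto_of_tendsto_of_tendsto_of_le_of_le' tendsto_const_nhds hb
    (Eventually.of_forall fun _ => norm_nonneg _) ?_
  filter_upwards [h1, self_mem_nhdsWithin] with u hu1 hu0
  have hu0 : 0 < u := hu0
  have key := Real.abs_log_sub_add_sum_range_le (x := -u) (by rw [abs_neg, abs_of_pos hu0]; exact hu1) 2
  simp only [Finset.sum_range_succ, Finset.sum_range_zero, abs_neg, sub_neg_eq_add] at key
  have e : (Real.log (1 + u) - u) / u ^ 2 - -1 / 2 = (0 + (-u) ^ (0 + 1) / ((0:ℕ) + 1) +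
      (-u) ^ (1 + 1) / ((1 : ℕ) + 1) + Real.log (1 + u)) / u ^ 2 := by
    field_simp; push_cast; ring
  rw [e, Real.norm_eq_abs, abs_div, abs_of_pos (pow_pos hu0 2), div_le_iff₀ (pow_pos hu0 2)]
  refine key.trans (le_of_eq ?_)
  rw [abs_of_pos hu0]; ring

lemma r_lim : Tendsto (fun n : ℕ => (n : ℝ) / ((n : ℝ) + 1)) atTop (nhds 1) :=
  tendsto_natCast_div_add_atTop (1 : ℝ)

lemma i_lim : Tendsto (fun n : ℕ => 1 / ((n : ℝ) + 1)) atTop (nhds 0) :=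
  tendsto_one_div_add_atTop_nhds_zero_nat

lemma a_lim {μ x : ℝ} (hμ : 0 < μ) (hx : 0 < x) :
    Tendsto (fun n : ℕ => (n : ℝ) * (aFun μ n x - x)) atTop
      (nhds (x * (1 - x) / (2 * (1 + μ)))) := by
  have hc : 0 < 1 + μ := by linarith
  set h : ℕ → ℝ := fun n => 1 / (((n : ℝ) + 1) * (1 + μ)) with hh
  have hpos : ∀ n, 0 < h n := fun n => by simp only [hh]; positivity
  have hlim : Tendsto h atTop (nhds 0) := by
    have := i_lim.div_const (1 + μ)
    rw [zero_div] at this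
    refine this.congr (fun n => ?_)
    simp only [hh]; field_simp
  have hw : Tendsto h atTop (nhdsWithin 0 (Ioi 0)) :=
    tendsto_nhdsWithin_iff.2 ⟨hlim, Eventually.of_forall hpos⟩
  have hxw : Tendsto (fun n => x * h n) atTop (nhdsWithin 0 (Ioi 0)) :=
    tendsto_nhdsWithin_iff.2 ⟨by simpa using hlim.const_mul x,
      Eventually.of_forall fun n => mul_pos hx (hpos n)⟩
  have p1 := log_quot.comp hw
  have p2 := log_quot.comp hxw
  have nh := r_lim.div_const (1 + μ)
  have main := nh.mul (((p2.const_mul (x ^ 2)).sub (p1.const_mul x)).div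
    ((hlim.mul p1).const_add 1) (by simp))
  have e : x * (1 - x) / (2 * (1 + μ)) = 1 / (1 + μ) * ((x ^ 2 * (-1 / 2) - x * (-1 / 2)) /
    (1 + 0 * (-1 / 2))) := by field_simp; ring
  rw [e]
  refine main.congr (fun n => ?_)
  have hp := hpos n
  have hl : 0 < Real.log (1 + h n) := Real.log_pos (by linarith)
  have ea : aFun μ n x = Real.log (1 + x * h n) / Real.log (1 + h n) := by
    simp only [aFun, hh]; congr 3; ring
  have en : (n : ℝ) / (n + 1) / (1 + μ) = n * h n := by
    simp only [hh]; field_simp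
  have ed : 1 + h n * ((Real.log (1 + h n) - h n) / h n ^ 2) = Real.log (1 + h n) / h n := by
    field_simp; ring
  simp only [Function.comp, Pi.div_apply]
  rw [ea, en, ed]
  field_simp
  ring

lemma a_mem {μ x : ℝ} (hμ : 0 < μ) (hx : 0 < x) (hx1 : x < 1) (n : ℕ) :
    0 ≤ aFun μ n x ∧ aFun μ n x ≤ 1 := by
  have hc : 0 < 1 + μ := by linarith
  have hm : 0 < ((n : ℝ) + 1) * (1 + μ) := by positivity
  have h1 : 0 < 1 / (((n : ℝ) + 1) * (1 + μ)) := by positivity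
  have h2 : 0 < x / (((n : ℝ) + 1) * (1 + μ)) := by positivity
  have hl : 0 < Real.log (1 + 1 / (((n : ℝ) + 1) * (1 + μ))) := Real.log_pos (by linarith)
  have hl2 : 0 < Real.log (1 + x / (((n : ℝ) + 1) * (1 + μ))) := Real.log_pos (by linarith)
  unfold aFun
  refine ⟨by positivity, ?_⟩
  rw [div_le_one hl]
  apply Real.log_le_log (by linarith)
  gcongr

section limits
variable {a : ℕ → ℝ} {x α : ℝ}

lemma a_conv (ha : Tendsto (fun n : ℕ => (n : ℝ) * (a n - x)) atTop (nhds α)) :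
    Tendsto a atTop (nhds x) := by
  have h := ((ha.add (r_lim.mul_const 0)).mul (tendsto_inv_atTop_nhds_zero_nat (𝕜 := ℝ))).add_const x
  simp only [mul_zero, add_zero, zero_add] at h
  refine h.congr' ?_
  filter_upwards [eventually_gt_atTop 0] with n hn
  have : (n : ℝ) ≠ 0 := by positivity
  field_simp; ring

lemma b_conv (ha : Tendsto (fun n : ℕ => (n : ℝ) * (a n - x)) atTop (nhds α)) :
    Tendsto (fun n : ℕ => (n : ℝ) * (a n - x) + 1 / 2 - x) atTop (nhds (α + 1 / 2 - x)) :=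
  (ha.add_const _).sub_const _

lemma T1_lim (ha : Tendsto (fun n : ℕ => (n : ℝ) * (a n - x)) atTop (nhds α)) :
    Tendsto (fun n : ℕ => (n : ℝ) * kT n (a n) (fun t => t - x)) atTop
      (nhds (α + 1 / 2 - x)) := by
  have h := r_lim.mul (b_conv ha)
  rw [one_mul] at h
  refine h.congr (fun n => ?_)
  rw [kT_one]; ring

lemma T2_lim (ha : Tendsto (fun n : ℕ => (n : ℝ) * (a n - x)) atTop (nhds α)) :
    Tendsto (fun n : ℕ => (n : ℝ) * kT n (a n) (fun t => (t - x) ^ 2)) atTop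
      (nhds (x * (1 - x))) := by
  have hc : Continuous (fun z : ℝ × ℝ × ℝ × ℝ => z.1 ^ 2 * (z.2.2.1 * (1 - z.2.2.1))
    + z.1 * z.2.1 * (z.2.2.2 ^ 2 + 1 / 12)) := by fun_prop
  have h := (hc.tendsto (1, 0, x, α + 1 / 2 - x)).comp
    (r_lim.prodMk_nhds (i_lim.prodMk_nhds ((a_conv ha).prodMk_nhds (b_conv ha))))
  have e : x * (1 - x) = (1:ℝ) ^ 2 * (x * (1 - x)) + 1 * 0 * ((α + 1 / 2 - x) ^ 2 + 1 / 12) := by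
    ring
  rw [e]
  refine h.congr (fun n => ?_)
  have : (n : ℝ) + 1 ≠ 0 := by positivity
  simp only [Function.comp]
  rw [kT_two]
  field_simp
  ring

lemma T4_lim (ha : Tendsto (fun n : ℕ => (n : ℝ) * (a n - x)) atTop (nhds α)) :
    Tendsto (fun n : ℕ => (n : ℝ) * kT n (a n) (fun t => (t - x) ^ 4)) atTop
      (nhds 0) := by
  have hc : Continuous (fun z : ℝ × ℝ × ℝ × ℝ => z.2.1 *
    (3 * z.1 ^ 2 * (z.1 - z.2.1) * (z.2.2.1 * (1 - z.2.2.1)) ^ 2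
    + z.1 ^ 2 * z.2.1 * ((z.2.2.1 * (1 - z.2.2.1)) * (1 - 3 * z.2.2.1 + 3 * z.2.2.1 ^ 2)
      + 4 * z.2.2.2 * ((z.2.2.1 * (1 - z.2.2.1)) * (1 - 2 * z.2.2.1))
      + 6 * z.2.2.2 ^ 2 * (z.2.2.1 * (1 - z.2.2.1)) + (z.2.2.1 * (1 - z.2.2.1)) / 2)
    + z.1 * z.2.1 ^ 2 * (z.2.2.2 ^ 4 + z.2.2.2 ^ 2 / 2 + 1 / 80))) := by fun_prop
  have h := (hc.tendsto (1, 0, x, α + 1 / 2 - x)).comp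
    (r_lim.prodMk_nhds (i_lim.prodMk_nhds ((a_conv ha).prodMk_nhds (b_conv ha))))
  simp only [zero_mul] at h
  refine h.congr (fun n => ?_)
  have : (n : ℝ) + 1 ≠ 0 := by positivity
  simp only [Function.comp]
  rw [kT_four n (a n) x _ rfl]
  generalize (n : ℝ) * (a n - x) + 1 / 2 - x = b
  field_simp
  ring

lemma rem_lim (hx : x ∈ Ioo (0:ℝ) 1)
    (ha : Tendsto (fun n : ℕ => (n : ℝ) * (a n - x)) atTop (nhds α))
    (ham : ∀ n, 0 ≤ a n ∧ a n ≤ 1) {R : ℝ → ℝ} (hR : ContinuousOn R (Icc 0 1))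
    (ho : R =o[nhds x] (fun t => (t - x) ^ 2)) :
    Tendsto (fun n : ℕ => (n : ℝ) * kT n (a n) R) atTop (nhds 0) := by
  rw [Metric.tendsto_nhds]
  intro ε hε
  obtain ⟨K, hK⟩ := isCompact_Icc.exists_bound_of_continuousOn hR
  have hK0 : 0 ≤ K := (norm_nonneg _).trans (hK x ⟨hx.1.le, hx.2.le⟩)
  obtain ⟨δ, hδ, H⟩ := Metric.eventually_nhds_iff.1 (ho.def (half_pos hε))
  have bound : ∀ t ∈ Icc (0:ℝ) 1, |R t| ≤ ε / 2 * (t - x) ^ 2 + K / δ ^ 4 * (t - x) ^ 4 := by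
    intro t ht
    by_cases hd : dist t x < δ
    · have := H hd
      rw [Real.norm_eq_abs, Real.norm_eq_abs, abs_of_nonneg (sq_nonneg (t - x))] at this
      have : 0 ≤ K / δ ^ 4 * (t - x) ^ 4 := by positivity
      linarith
    · have h1 : |R t| ≤ K := hK t ht
      have h2 : δ ≤ |t - x| := by rw [← Real.dist_eq]; exact not_lt.1 hd
      have h3 : δ ^ 4 ≤ (t - x) ^ 4 := by
        rw [← Even.pow_abs (by decide : Even 4) (t - x)]; gcongr
      have h4 : K ≤ K / δ ^ 4 * (t - x) ^ 4 := by
        rw [div_mul_eq_mul_div, le_div_iff₀ (by positivity)]; gcongr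
      have : 0 ≤ ε / 2 * (t - x) ^ 2 := by positivity
      linarith
  have L := ((T2_lim ha).const_mul (ε / 2)).add ((T4_lim ha).const_mul (K / δ ^ 4))
  have hlt : ε / 2 * (x * (1 - x)) + K / δ ^ 4 * 0 < ε := by
    have h1 : x * (1 - x) ≤ 1 := by nlinarith [hx.1, hx.2]
    have h2 := mul_le_mul_of_nonneg_left h1 (half_pos hε).le
    linarith
  filter_upwards [L.eventually (gt_mem_nhds hlt)] with n hn
  rw [dist_zero_right, norm_mul, Real.norm_eq_abs, Real.norm_eq_abs, Nat.abs_cast]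
  refine lt_of_le_of_lt ?_ hn
  have := kT_abs (n := n) (ham n).1 (ham n).2 hR (by fun_prop) bound
  rw [kT_add (by fun_prop) (by fun_prop), kT_mul, kT_mul] at this
  calc _ ≤ (n : ℝ) * _ := mul_le_mul_of_nonneg_left this (Nat.cast_nonneg n)
    _ = _ := by ring

lemma voron (hx : x ∈ Ioo (0:ℝ) 1)
    (ha : Tendsto (fun n : ℕ => (n : ℝ) * (a n - x)) atTop (nhds α))
    (ham : ∀ n, 0 ≤ a n ∧ a n ≤ 1) {g : ℝ → ℝ} (hg : ContinuousOn g (Icc 0 1)) (A B : ℝ)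
    (ho : (fun t => g t - (g x + A * (t - x) + B / 2 * (t - x) ^ 2))
      =o[nhds x] (fun t => (t - x) ^ 2)) :
    Tendsto (fun n : ℕ => (n : ℝ) * (kT n (a n) g - g x)) atTop
      (nhds (A * (α + 1 / 2 - x) + B / 2 * (x * (1 - x)))) := by
  have hR : ContinuousOn (fun t => g t - (g x + A * (t - x) + B / 2 * (t - x) ^ 2)) (Icc 0 1) := by
    fun_prop
  have L := (((T1_lim ha).const_mul A).add ((T2_lim ha).const_mul (B / 2))).add
    (rem_lim hx ha ham hR ho)
  rw [add_zero] at L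
  refine L.congr (fun n => ?_)
  have e : kT n (a n) g = kT n (a n) (fun _ => g x) + A * kT n (a n) (fun t => t - x)
      + B / 2 * kT n (a n) (fun t => (t - x) ^ 2)
      + kT n (a n) (fun t => g t - (g x + A * (t - x) + B / 2 * (t - x) ^ 2)) := by
    rw [← kT_mul, ← kT_mul, ← kT_add (by fun_prop) (by fun_prop),
      ← kT_add (by fun_prop) (by fun_prop), ← kT_add (by fun_prop) (by fun_prop)]
    congr 1; ext t; ring
  rw [e, kT_zero]; ring

end limits

lemma taylor2 {g : ℝ → ℝ} (hg : ContDiffOn ℝ 2 g (Ioo 0 1)) {x : ℝ} (hx : x ∈ Ioo (0:ℝ) 1) :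
    (fun t => g t - (g x + deriv g x * (t - x) + deriv (deriv g) x / 2 * (t - x) ^ 2))
      =o[nhds x] (fun t => (t - x) ^ 2) := by
  have h := taylor_isLittleO (n := 2) (convex_Ioo 0 1) hx (by exact_mod_cast hg)
  rw [isOpen_Ioo.nhdsWithin_eq hx] at h
  have e1 : iteratedDerivWithin 1 g (Ioo 0 1) x = deriv g x := by
    rw [iteratedDerivWithin_of_isOpen isOpen_Ioo hx, iteratedDeriv_one]
  have e2 : iteratedDerivWithin 2 g (Ioo 0 1) x = deriv (deriv g) x := by
    rw [iteratedDerivWithin_of_isOpen isOpen_Ioo hx, iteratedDeriv_succ, iteratedDeriv_one]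
  refine h.congr_left (fun t => ?_)
  rw [taylorWithinEval_succ, taylorWithinEval_succ, taylor_within_zero_eval]
  simp only [zero_add, Nat.reduceAdd, e1, e2, smul_eq_mul]
  norm_num [Nat.factorial]
  ring

theorem stmt13 (μ : ℝ) (hμ : 0 < μ) (f : ℝ → ℝ)
    (hf : ContinuousOn f (Set.Icc 0 1))
    (hf2 : ContDiffOn ℝ 2 (fun t => f t / lnMu μ t) (Set.Ioo 0 1)) :
    (∀ x ∈ Set.Ioo (0:ℝ) 1,
        Tendsto (fun n : ℕ => (n : ℝ) * (LK μ n f x - f x)) atTop (nhds 0)) ↔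
      ∀ x ∈ Set.Ioo (0:ℝ) 1,
        (1 + μ - x * (1 + 2 * μ) - x ^ 2) * deriv (fun t => f t / lnMu μ t) x +
            (1 + μ) * (x - x ^ 2) * deriv (deriv (fun t => f t / lnMu μ t)) x = 0 := by
  have hpos : ∀ t ∈ Icc (0:ℝ) 1, 0 < lnMu μ t := fun t ht =>
    Real.log_pos (by linarith [ht.1])
  have hg : ContinuousOn (fun t => f t / lnMu μ t) (Icc 0 1) := by
    refine hf.div ?_ (fun t ht => (hpos t ht).ne')
    unfold lnMu
    exact ContinuousOn.log (by fun_prop) (fun t ht => by linarith [ht.1])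
  refine forall₂_congr (fun x hx => ?_)
  have hc : 0 < 1 + μ := by linarith
  have hl := hpos x ⟨hx.1.le, hx.2.le⟩
  have V := (voron hx (a_lim hμ hx.1) (a_mem hμ hx.1 hx.2) hg _ _ (taylor2 hf2 hx)).const_mul
    (lnMu μ x)
  have V' := V.congr (f₂ := fun n : ℕ => (n : ℝ) * (LK μ n f x - f x)) (fun n => by
    have : LK μ n f x = lnMu μ x * kT n (aFun μ n x) (fun t => f t / lnMu μ t) := rfl
    rw [this]
    field_simp)
  generalize deriv (deriv (fun t => f t / lnMu μ t)) x = D2 at *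
  generalize deriv (fun t => f t / lnMu μ t) x = D1 at *
  have e : (1 + μ - x * (1 + 2 * μ) - x ^ 2) * D1 + (1 + μ) * (x - x ^ 2) * D2
      = 2 * (1 + μ) / lnMu μ x * (lnMu μ x * (D1 * (x * (1 - x) / (2 * (1 + μ)) + 1 / 2 - x)
        + D2 / 2 * (x * (1 - x)))) := by
    field_simp; ring
  rw [e]
  constructor
  · intro h
    rw [← tendsto_nhds_unique h V', mul_zero]
  · intro h
    have hne : 2 * (1 + μ) / lnMu μ x ≠ 0 := by positivity
    rw [(mul_eq_zero.1 h).resolve_left hne] at V'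
    exact V'
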